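/- arXiv:1208.4854 — 2 statements merged into one kernel-verified Lean document; each statement's English description precedes it below -/
import Mathlib

section
/- For every integer n ≥ 1 and every integer j ≥ 2, |db(n,j)| ≤ (3/4) · √(π/(2(2n−1))), where π is the real number pi. -/
open scoped Classical

/-- A deal of size `n` is a fixed-point-free involution of `Fin (2*n)`. -/
def IsDeal (n : ℕ) (π : Fin (2*n) → Fin (2*n)) : Prop :=
  ∀ j, π (π j) = j ∧ π j ≠ j

/-- The finite set `D_n` of all deals of size `n`. -/
noncomputable def deals (n : ℕ) : Finset (Fin (2*n) → Fin (2*n)) :=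
  Finset.univ.filter (IsDeal n)

/-- The second occurrences of `π` (positions `j` with `π j < j`), in
increasing order: `j_1 < j_2 < ... < j_n`. -/
def blockEnds {n : ℕ} (π : Fin (2*n) → Fin (2*n)) : List (Fin (2*n)) :=
  (Finset.univ.filter (fun j => π j < j)).sort (· ≤ ·)

/-- The block lengths `b_1, ..., b_n` of a deal:
`b_1 = j_1 + 1` and `b_i = j_i - j_(i-1)` for `i ≥ 2`. -/
def blockLens {n : ℕ} (π : Fin (2*n) → Fin (2*n)) : List ℕ :=
  List.zipWith (fun x y => x - y)
    ((blockEnds π).map (fun j => (j : ℕ) + 1))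
    (0 :: (blockEnds π).map (fun j => (j : ℕ) + 1))

/-- The blocks of a deal: each block length `b_i` paired with the ending
position `j_i` of the block. -/
def blocks {n : ℕ} (π : Fin (2*n) → Fin (2*n)) : List (ℕ × Fin (2*n)) :=
  List.zip (blockLens π) (blockEnds π)

/-- The `i`-th block (ending at position `j_i`) is lucky if `π j_i = j_i - 1`. -/
def IsLuckyEnd {n : ℕ} (π : Fin (2*n) → Fin (2*n)) (j : Fin (2*n)) : Prop :=
  (π j).val = (j : ℕ) - 1

/-- `b(n,j)`: total number of blocks of length `j` over all deals in `D_n`. -/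
noncomputable def bcount (n j : ℕ) : ℕ :=
  ∑ π ∈ deals n, (blockLens π).count j

/-- `l(n,j)`: total number of lucky blocks of length `j` over all deals in `D_n`. -/
noncomputable def lcount (n j : ℕ) : ℕ :=
  ∑ π ∈ deals n, (blocks π).countP (fun p => decide (p.1 = j ∧ IsLuckyEnd π p.2))

/-- `eb(n,j)`: the expected number of blocks of length `j` in a random deal. -/
noncomputable def eb (n j : ℕ) : ℝ := (bcount n j : ℝ) / ((deals n).card : ℝ)

/-- `el(n,j)`: the expected number of lucky blocks of length `j` in a random deal. -/
noncomputable def el (n j : ℕ) : ℝ := (lcount n j : ℝ) / ((deals n).card : ℝ)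

/-- `db(n,j) = eb(n,j) - 2(2n+1)/(j(j+1)(j+2))`. -/
noncomputable def db (n j : ℕ) : ℝ :=
  eb n j - 2*(2*(n:ℝ)+1) / ((j:ℝ) * ((j:ℝ)+1) * ((j:ℝ)+2))

/-- `dl(n,j) = el(n,j) - 1/(j(j-1))`. -/
noncomputable def dl (n j : ℕ) : ℝ :=
  el n j - 1 / ((j:ℝ) * ((j:ℝ)-1))

/-- `e(π)`: the number of blocks of `π` of even length. -/
noncomputable def evenBlocks {n : ℕ} (π : Fin (2*n) → Fin (2*n)) : ℕ :=
  (blockLens π).countP (fun b => decide (Even b))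

/-- `l(π)`: the number of even-length lucky blocks of `π`. -/
noncomputable def luckyEvenBlocks {n : ℕ} (π : Fin (2*n) → Fin (2*n)) : ℕ :=
  (blocks π).countP (fun p => decide (Even p.1 ∧ IsLuckyEnd π p.2))

/-- The involutions of `α` whose set of moved points is `S`. -/
noncomputable def involutionsOn {α : Type*} [Fintype α] (S : Finset α) : Finset (α → α) :=
  Finset.univ.filter fun f => ∀ i, f (f i) = i ∧ (f i ≠ i ↔ i ∈ S)

lemma mem_involutionsOn {α : Type*} [Fintype α] {S : Finset α} {f : α → α} :
    f ∈ involutionsOn S ↔ ∀ i, f (f i) = i ∧ (f i ≠ i ↔ i ∈ S) := by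
  simp [involutionsOn]

lemma deals_eq_involutionsOn (n : ℕ) : deals n = involutionsOn Finset.univ := by
  ext f
  simp [deals, IsDeal, mem_involutionsOn]

/-- The number of perfect matchings of a `k`-element set. -/
def matchingCount : ℕ → ℕ
  | 0 => 1
  | 1 => 0
  | k + 2 => (k + 1) * matchingCount k

/-- Removing the pair `{a, x}` from an involution that exchanges `a` and `x`. -/
lemma card_involutionsOn_apply_eq {α : Type*} [Fintype α] {S W R : Finset α} {a x : α}
    (ha : a ∈ S) (hx : x ∈ S) (hax : a ≠ x) (haW : a ∉ W) (hxW : x ∉ W) (haR : a ∉ R) :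
    ((involutionsOn S).filter fun f => f a = x ∧ ∀ i ∈ W, f i ∈ R).card =
      ((involutionsOn ((S.erase a).erase x)).filter fun g => ∀ i ∈ W, g i ∈ R.erase x).card := by
  refine Finset.card_nbij' (fun f i => if i = a ∨ i = x then i else f i)
    (fun g i => if i = a then x else if i = x then a else g i) ?_ ?_ ?_ ?_
  · intro f hf
    simp only [Finset.coe_filter, Set.mem_ofPred_eq, mem_involutionsOn] at hf ⊢
    obtain ⟨h1, h2, h3⟩ := hf
    have hfx : f x = a := h2 ▸ (h1 a).1
    refine ⟨fun i => ?_, fun i hi => ?_⟩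
    · have := h1 i
      have h4 := h1 (f i)
      simp only [Finset.mem_erase]
      grind
    · have := h1 i
      have := h3 i hi
      simp only [Finset.mem_erase]
      grind
  · intro g hg
    simp only [Finset.coe_filter, Set.mem_ofPred_eq, mem_involutionsOn, Finset.mem_erase] at hg ⊢
    obtain ⟨h1, h3⟩ := hg
    have hga := h1 a
    have hgx := h1 x
    refine ⟨fun i => ?_, by simp, fun i hi => ?_⟩
    · have := h1 i
      grind
    · have := h3 i hi
      grind
  · intro f hf
    simp only [Finset.coe_filter, Set.mem_ofPred_eq, mem_involutionsOn] at hf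
    obtain ⟨h1, h2, h3⟩ := hf
    have hfx : f x = a := h2 ▸ (h1 a).1
    funext i
    grind
  · intro g hg
    simp only [Finset.coe_filter, Set.mem_ofPred_eq, mem_involutionsOn, Finset.mem_erase] at hg
    obtain ⟨h1, h3⟩ := hg
    have hga := h1 a
    have hgx := h1 x
    funext i
    grind

lemma card_involutionsOn {α : Type*} [Fintype α] (S : Finset α) :
    (involutionsOn S).card = matchingCount S.card := by
  induction hk : S.card using Nat.strong_induction_on generalizing S with
  | _ k ih =>
  rcases S.eq_empty_or_nonempty with rfl | ⟨a, ha⟩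
  · have : involutionsOn (∅ : Finset α) = {id} := by
      ext f
      simp only [mem_involutionsOn, Finset.mem_singleton, funext_iff, id]
      grind
    rw [this, ← hk]
    rfl
  · have hmaps : ∀ f ∈ involutionsOn S, f a ∈ S.erase a := by
      intro f hf
      rw [mem_involutionsOn] at hf
      have := hf a
      have := hf (f a)
      grind
    rw [Finset.card_eq_sum_card_fiberwise hmaps]
    have hfib : ∀ x ∈ S.erase a,
        ((involutionsOn S).filter fun f => f a = x).card = matchingCount (k - 2) := by
      intro x hx
      have hx' := Finset.mem_erase.1 hx
      have h := card_involutionsOn_apply_eq (W := ∅) (R := ∅) ha hx'.2 hx'.1.symm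
        (by simp) (by simp) (by simp)
      simp only [Finset.notMem_empty, false_implies, implies_true, and_true,
        Finset.filter_true] at h
      have hc : ((S.erase a).erase x).card = k - 2 := by
        rw [Finset.card_erase_of_mem hx, Finset.card_erase_of_mem ha, hk]; omega
      rw [h, ih (k - 2) (by have := Finset.card_pos.2 ⟨a, ha⟩; omega) _ hc]
    rw [Finset.sum_congr rfl hfib, Finset.sum_const, Finset.card_erase_of_mem ha, hk]
    rcases k with _ | _ | k
    · exact absurd (Finset.card_pos.2 ⟨a, ha⟩) (by simp [hk])
    · simp [matchingCount]
    · simp [matchingCount]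

lemma card_involutionsOn_mapsTo {α : Type*} [Fintype α] {S W R : Finset α}
    (hW : W ⊆ S) (hR : R ⊆ S) (hWR : Disjoint W R) :
    ((involutionsOn S).filter fun f => ∀ i ∈ W, f i ∈ R).card =
      R.card.descFactorial W.card * matchingCount (S.card - 2 * W.card) := by
  induction W using Finset.induction_on generalizing S R with
  | empty => simp [card_involutionsOn]
  | insert a W haW ih =>
    have ha : a ∈ S := hW (Finset.mem_insert_self a W)
    have haR : a ∉ R := Finset.disjoint_left.1 hWR (Finset.mem_insert_self a W)
    have hmaps : ∀ f ∈ (involutionsOn S).filter fun f => ∀ i ∈ insert a W, f i ∈ R,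
        f a ∈ R := fun f hf => (Finset.mem_filter.1 hf).2 a (Finset.mem_insert_self a W)
    rw [Finset.card_eq_sum_card_fiberwise hmaps]
    have hfib : ∀ x ∈ R,
        (((involutionsOn S).filter fun f => ∀ i ∈ insert a W, f i ∈ R).filter
          fun f => f a = x).card =
        (R.card - 1).descFactorial W.card *
          matchingCount (S.card - 2 * (insert a W).card) := by
      intro x hx
      have hax : a ≠ x := fun h => haR (h ▸ hx)
      have hxW : x ∉ W := fun h =>
        Finset.disjoint_left.1 hWR (Finset.mem_insert_of_mem h) hx
      have hc : ((S.erase a).erase x).card = S.card - 2 := by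
        rw [Finset.card_erase_of_mem (Finset.mem_erase.2 ⟨hax.symm, hR hx⟩),
          Finset.card_erase_of_mem ha]
        omega
      have h1 : (((involutionsOn S).filter fun f => ∀ i ∈ insert a W, f i ∈ R).filter
          fun f => f a = x) =
          (involutionsOn S).filter fun f => f a = x ∧ ∀ i ∈ W, f i ∈ R := by
        ext f
        simp only [Finset.mem_filter, Finset.mem_insert]
        grind
      rw [h1, card_involutionsOn_apply_eq ha (hR hx) hax haW hxW haR,
        ih (S := (S.erase a).erase x) (R := R.erase x), hc, Finset.card_erase_of_mem hx,
        Finset.card_insert_of_notMem haW]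
      · congr 2
        omega
      · intro i hi
        have := hW (Finset.mem_insert_of_mem hi)
        simp only [Finset.mem_erase]
        grind
      · intro i hi
        have := hR (Finset.mem_of_mem_erase hi)
        simp only [Finset.mem_erase] at hi ⊢
        grind
      · exact (hWR.mono_left (Finset.subset_insert a W)).mono_right (Finset.erase_subset x R)
    rw [Finset.sum_congr rfl hfib, Finset.sum_const, Finset.card_insert_of_notMem haW,
      smul_eq_mul, ← mul_assoc]
    congr 1
    cases R.card with
    | zero => simp
    | succ r => rw [Nat.succ_descFactorial_succ, Nat.add_sub_cancel]

/-- In a strictly increasing list above `b`, the gap `j` occurs once for each element `x` such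
that `x - j` lies in `b :: l` and nothing of `l` lies strictly in between. -/
lemma count_zipWith_sub_cons {j : ℕ} (hj : 1 ≤ j) (l : List ℕ) (b : ℕ)
    (hl : (b :: l).Pairwise (· < ·)) :
    (List.zipWith (fun x y => x - y) l (b :: l)).count j =
      l.countP fun x => decide (∃ y ∈ b :: l, x = y + j ∧ ∀ z ∈ l, y < z → x ≤ z) := by
  induction l generalizing b with
  | nil => simp
  | cons c l ih =>
    have hl' := List.pairwise_cons.1 hl
    have hbc : b < c := hl'.1 c (by simp)
    have hc := (List.pairwise_cons.1 hl'.2).1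
    rw [List.zipWith_cons_cons, List.count_cons, List.countP_cons, ih c hl'.2]
    congr 1
    · apply List.countP_congr
      intro x hx
      have hcx := hc x hx
      simp only [decide_eq_true_eq]
      constructor
      · rintro ⟨y, hy, rfl, h⟩
        refine ⟨y, List.mem_cons_of_mem _ hy, rfl, fun z hz hyz => ?_⟩
        rcases List.mem_cons.1 hz with rfl | hz
        · rcases List.mem_cons.1 hy with rfl | hy
          · omega
          · have := hc y hy; omega
        · exact h z hz hyz
      · rintro ⟨y, hy, rfl, h⟩
        rcases List.mem_cons.1 hy with rfl | hy
        · have := h c (by simp) hbc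
          omega
        · exact ⟨y, hy, rfl, fun z hz => h z (List.mem_cons_of_mem _ hz)⟩
    · congr 1
      simp only [beq_iff_eq, decide_eq_true_eq, eq_iff_iff]
      constructor
      · intro h
        refine ⟨b, by simp, by omega, fun z hz _ => ?_⟩
        rcases List.mem_cons.1 hz with rfl | hz
        · exact le_rfl
        · exact (hc z hz).le
      · rintro ⟨y, hy, hcy, h⟩
        rcases List.mem_cons.1 hy with rfl | hy
        · omega
        · rcases List.mem_cons.1 hy with hy | hy
          · omega
          · have := hc y hy; omega

/-- Position `p` of the deal is a first occurrence. -/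
def IsFirst {n : ℕ} (π : Fin (2*n) → Fin (2*n)) (p : ℕ) : Prop :=
  ∃ h : p < 2 * n, p < (π ⟨p, h⟩ : ℕ)

lemma IsFirst.lt {n : ℕ} {π : Fin (2*n) → Fin (2*n)} {p : ℕ} (h : IsFirst π p) :
    p + 1 < 2 * n := by
  obtain ⟨h1, h2⟩ := h
  have := (π ⟨p, h1⟩).isLt
  omega

lemma apply_lt_iff_not_isFirst {n : ℕ} {π : Fin (2*n) → Fin (2*n)} (hπ : IsDeal n π)
    (p : Fin (2*n)) : π p < p ↔ ¬ IsFirst π p := by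
  have h1 : ((π p : ℕ) ≠ p) := fun h => (hπ p).2 (Fin.ext h)
  simp only [IsFirst, p.isLt, exists_true_left, Fin.eta, Fin.lt_def]
  omega

lemma blockLens_eq_zipWith {n : ℕ} (π : Fin (2*n) → Fin (2*n)) :
    blockLens π = List.zipWith (fun x y => x - y)
      ((blockEnds π).map fun p : Fin (2*n) => (p : ℕ) + 1)
      (0 :: (blockEnds π).map fun p : Fin (2*n) => (p : ℕ) + 1) := by
  have h : (do let a ← blockEnds π; pure (a : ℕ)) = (blockEnds π).map fun p : Fin (2*n) => (p : ℕ) :=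
    List.flatMap_pure_eq_map _ _
  rw [blockLens, h, List.map_map]
  rfl

lemma count_blockLens {n j : ℕ} (hj : 1 ≤ j) {π : Fin (2*n) → Fin (2*n)} (hπ : IsDeal n π) :
    (blockLens π).count j = ((Finset.range (2 * n)).filter fun y =>
      (∀ i < j - 1, IsFirst π (y + i)) ∧ ¬ (∀ i < j, IsFirst π (y + i)) ∧ y + j ≤ 2 * n ∧
        ∀ z, y = z + 1 → ¬ IsFirst π z).card := by
  set l := (blockEnds π).map fun p : Fin (2*n) => (p : ℕ) + 1 with hl
  have hmem : ∀ z, z ∈ l ↔ ∃ p, z = p + 1 ∧ p < 2 * n ∧ ¬ IsFirst π p := by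
    intro z
    simp only [hl, blockEnds, List.mem_map, Finset.mem_sort, Finset.mem_filter,
      Finset.mem_univ, true_and, apply_lt_iff_not_isFirst hπ]
    constructor
    · rintro ⟨p, hp, rfl⟩
      exact ⟨p, rfl, p.isLt, hp⟩
    · rintro ⟨p, rfl, h, hp⟩
      exact ⟨⟨p, h⟩, hp, rfl⟩
  have hsort : l.Pairwise (· < ·) := by
    refine List.Pairwise.map _ (fun a b h => ?_) (Finset.sortedLT_sort _).pairwise
    exact Nat.succ_lt_succ h
  have hpair : (0 :: l).Pairwise (· < ·) := by
    refine List.pairwise_cons.2 ⟨fun z hz => ?_, hsort⟩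
    obtain ⟨p, rfl, -⟩ := (hmem z).1 hz
    omega
  rw [blockLens_eq_zipWith, count_zipWith_sub_cons hj l 0 hpair, List.countP_eq_length_filter,
    ← List.toFinset_card_of_nodup ((hsort.imp ne_of_lt).filter _)]
  refine Finset.card_nbij' (fun x => x - j) (fun y => y + j) ?_ ?_ ?_ ?_
  · intro x hx
    simp only [List.coe_toFinset, Set.mem_ofPred_eq, List.mem_filter, decide_eq_true_eq] at hx
    obtain ⟨hx, y, hy, rfl, h⟩ := hx
    obtain ⟨p, hp, hp2, hp3⟩ := (hmem _).1 hx
    simp only [Finset.coe_filter, Finset.mem_range, Set.mem_ofPred_eq, Nat.add_sub_cancel]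
    refine ⟨by omega, fun i hi => ?_, fun h => ?_, by omega, fun z hz => ?_⟩
    · by_contra hf
      have := h (y + i + 1) ((hmem _).2 ⟨y + i, rfl, by omega, hf⟩) (by omega)
      omega
    · have h2 := h (j - 1) (by omega)
      exact hp3 ((by omega : y + (j - 1) = p) ▸ h2)
    · subst hz
      rcases List.mem_cons.1 hy with h0 | hy
      · omega
      · obtain ⟨q, hq, -, hq2⟩ := (hmem _).1 hy
        obtain rfl : z = q := by omega
        exact hq2
  · intro y hy
    simp only [Finset.coe_filter, Finset.mem_range, Set.mem_ofPred_eq] at hy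
    obtain ⟨hy, h1, h2, h3, h4⟩ := hy
    simp only [List.coe_toFinset, Set.mem_ofPred_eq, List.mem_filter, decide_eq_true_eq]
    refine ⟨(hmem _).2 ⟨y + (j - 1), by omega, by omega, fun hf => h2 fun i hi => ?_⟩, y, ?_,
      rfl, fun z hz hyz => ?_⟩
    · rcases (by omega : i < j - 1 ∨ i = j - 1) with hi | rfl
      · exact h1 i hi
      · exact hf
    · rcases y with _ | z
      · simp
      · exact List.mem_cons_of_mem _ ((hmem _).2 ⟨z, rfl, by omega, h4 z rfl⟩)
    · obtain ⟨p, rfl, -, hp⟩ := (hmem _).1 hz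
      by_contra hlt
      refine hp ?_
      have := h1 (p - y) (by omega)
      rwa [Nat.add_sub_cancel' (by omega)] at this
  · intro x hx
    simp only [List.coe_toFinset, Set.mem_ofPred_eq, List.mem_filter, decide_eq_true_eq] at hx
    obtain ⟨hx, y, hy, rfl, h⟩ := hx
    simp
  · intro y hy
    simp

/-- The number of windows of `m` consecutive first occurrences. -/
noncomputable def windowCount {n : ℕ} (π : Fin (2*n) → Fin (2*n)) (m : ℕ) : ℕ :=
  ((Finset.range (2 * n)).filter fun y => ∀ i < m, IsFirst π (y + i)).card

lemma count_blockLens_add {n m : ℕ} (hm : 1 ≤ m) {π : Fin (2*n) → Fin (2*n)}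
    (hπ : IsDeal n π) :
    (blockLens π).count (m + 1) + 2 * windowCount π (m + 1) =
      windowCount π m + windowCount π (m + 2) := by
  set A : ℕ → Finset ℕ := fun m => (Finset.range (2 * n)).filter fun y =>
    (∀ i < m, IsFirst π (y + i)) ∧ ¬ (∀ i < m + 1, IsFirst π (y + i)) with hA
  have hwin : ∀ m, windowCount π (m + 1) + (A m).card = windowCount π m := by
    intro m
    simp only [windowCount, hA]
    rw [← Finset.card_filter_add_card_filter_not
      (s := (Finset.range (2 * n)).filter fun y => ∀ i < m, IsFirst π (y + i))
      (fun y => ∀ i < m + 1, IsFirst π (y + i)), Finset.filter_filter, Finset.filter_filter]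
    congr 2
    refine Finset.filter_congr fun y _ => ⟨fun h => ⟨fun i hi => h i (by omega), h⟩, And.right⟩
  have hcount : (blockLens π).count (m + 1) + (A (m + 1)).card = (A m).card := by
    rw [count_blockLens (by omega) hπ, ← Finset.card_filter_add_card_filter_not
      (s := A m) (fun y => ∀ z, y = z + 1 → ¬ IsFirst π z)]
    congr 1
    · simp only [hA, Finset.filter_filter, Nat.add_sub_cancel]
      congr 1
      refine Finset.filter_congr fun y _ => ?_
      refine ⟨fun h => ⟨⟨h.1, h.2.1⟩, h.2.2.2⟩, fun h => ⟨h.1.1, h.1.2, ?_, h.2⟩⟩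
      have := (h.1.1 (m - 1) (by omega)).lt
      omega
    · refine Finset.card_nbij' (fun y => y + 1) (fun y => y - 1) ?_ ?_ ?_ ?_
      · intro y hy
        simp only [hA, Finset.coe_filter, Finset.mem_filter, Finset.mem_range,
          Set.mem_ofPred_eq] at hy ⊢
        obtain ⟨hy, h1, h2⟩ := hy
        have h0 := h1 0 (by omega)
        refine ⟨⟨h0.lt, fun i hi => ?_, fun h => h2 fun i hi => ?_⟩, fun h => h y rfl h0⟩
        · have := h1 (i + 1) (by omega)
          rwa [add_assoc, add_comm 1 i]
        · rcases i with _ | i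
          · exact h0
          · have := h i (by omega)
            rwa [add_assoc, add_comm 1 i] at this
      · intro y hy
        simp only [hA, Finset.coe_filter, Finset.mem_filter, Finset.mem_range,
          Set.mem_ofPred_eq] at hy ⊢
        obtain ⟨⟨hy, h1, h2⟩, h3⟩ := hy
        push Not at h3
        obtain ⟨z, rfl, hz⟩ := h3
        simp only [Nat.add_sub_cancel]
        refine ⟨by omega, fun i hi => ?_, fun h => h2 fun i hi => ?_⟩
        · rcases i with _ | i
          · exact hz
          · have := h1 i (by omega)
            rwa [add_assoc, add_comm 1 i] at this
        · have := h (i + 1) (by omega)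
          rwa [add_assoc, add_comm 1 i]
      · intro y _
        simp
      · intro y hy
        simp only [hA, Finset.coe_filter, Finset.mem_filter, Finset.mem_range,
          Set.mem_ofPred_eq] at hy
        have h3 := hy.2
        push Not at h3
        obtain ⟨z, rfl, hz⟩ := h3
        simp
  have h1 := hwin m
  have h2 : windowCount π (m + 2) + _ = _ := hwin (m + 1)
  omega

lemma card_deals_window (n y m : ℕ) (hm : 1 ≤ m) :
    ((deals n).filter fun π => ∀ i < m, IsFirst π (y + i)).card =
      (2 * n - y - m).descFactorial m * matchingCount (2 * n - 2 * m) := by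
  rcases lt_or_ge (2 * n) (y + m) with h | h
  · rw [Nat.descFactorial_eq_zero_iff_lt.2 (by omega), zero_mul, Finset.card_eq_zero,
      Finset.filter_eq_empty_iff]
    intro π _ hπ
    have := (hπ (m - 1) (by omega)).lt
    omega
  · set W : Finset (Fin (2*n)) := Finset.univ.filter fun p => y ≤ p.val ∧ p.val < y + m with hW
    set R : Finset (Fin (2*n)) := Finset.univ.filter fun p => y + m ≤ p.val with hR
    have hWc : W.card = m := by
      have : W.map Fin.valEmbedding = Finset.Ico y (y + m) := by
        ext p
        simp only [hW, Finset.mem_map, Finset.mem_filter, Finset.mem_univ, true_and,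
          Fin.valEmbedding_apply, Finset.mem_Ico]
        exact ⟨by rintro ⟨a, h, rfl⟩; exact h, fun h => ⟨⟨p, by omega⟩, h, rfl⟩⟩
      rw [← Finset.card_map Fin.valEmbedding, this]
      simp
    have hRc : R.card = 2 * n - y - m := by
      have : R.map Fin.valEmbedding = Finset.Ico (y + m) (2 * n) := by
        ext p
        simp only [hR, Finset.mem_map, Finset.mem_filter, Finset.mem_univ, true_and,
          Fin.valEmbedding_apply, Finset.mem_Ico]
        exact ⟨by rintro ⟨a, h, rfl⟩; exact ⟨h, a.isLt⟩, fun h => ⟨⟨p, h.2⟩, h.1, rfl⟩⟩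
      rw [← Finset.card_map Fin.valEmbedding, this]
      simp
      omega
    have hdisj : Disjoint W R := by
      rw [Finset.disjoint_left]
      intro p hp hq
      simp only [hW, hR, Finset.mem_filter, Finset.mem_univ, true_and] at hp hq
      omega
    have key := card_involutionsOn_mapsTo (Finset.subset_univ W) (Finset.subset_univ R) hdisj
    rw [hWc, hRc, Finset.card_univ, Fintype.card_fin, ← deals_eq_involutionsOn] at key
    rw [← key]
    congr 1
    ext π
    simp only [Finset.mem_filter]
    refine and_congr_right fun hπ => ?_
    have hπ : IsDeal n π := (Finset.mem_filter.1 hπ).2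
    simp only [hW, hR, Finset.mem_filter, Finset.mem_univ, true_and]
    constructor
    · intro hf p hp
      by_contra hlt
      have hfirst : ∀ q : Fin (2*n), y ≤ q.val → q.val < y + m → q.val < (π q).val := by
        intro q h1 h2
        obtain ⟨h3, h4⟩ := hf (q.val - y) (by omega)
        simp only [Nat.add_sub_cancel' h1, Fin.eta] at h4
        exact h4
      have h1 := hfirst p hp.1 hp.2
      have h2 := hfirst (π p) (by omega) (by omega)
      rw [(hπ p).1] at h2
      omega
    · intro hf i hi
      have := hf ⟨y + i, by omega⟩ ⟨by simp, by simpa using hi⟩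
      exact ⟨by omega, by omega⟩

lemma succ_mul_sum_range_descFactorial (m k : ℕ) :
    (m + 1) * ∑ r ∈ Finset.range k, r.descFactorial m = k.descFactorial (m + 1) := by
  induction k with
  | zero => simp
  | succ k ih =>
    rw [Finset.sum_range_succ, mul_add, ih, Nat.succ_descFactorial_succ, Nat.descFactorial_succ,
      ← add_mul]
    rcases lt_or_ge k m with h | h
    · simp [Nat.descFactorial_eq_zero_iff_lt.2 h]
    · congr 1
      omega

lemma succ_mul_sum_windowCount (n m : ℕ) (hm : 1 ≤ m) :
    (m + 1) * ∑ π ∈ deals n, windowCount π m =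
      (2 * n + 1 - m).descFactorial (m + 1) * matchingCount (2 * n - 2 * m) := by
  have h1 : ∑ π ∈ deals n, windowCount π m =
      ∑ y ∈ Finset.range (2 * n), (2 * n - y - m).descFactorial m *
        matchingCount (2 * n - 2 * m) := by
    simp only [windowCount, Finset.card_filter, ← card_deals_window n _ m hm]
    exact Finset.sum_comm
  have h2 : ∑ y ∈ Finset.range (2 * n), (2 * n - y - m).descFactorial m =
      ∑ r ∈ Finset.range (2 * n + 1 - m), r.descFactorial m := by
    rw [← Finset.sum_range_reflect _ (2 * n + 1 - m)]
    symm
    refine Finset.sum_subset_zero_on_sdiff (fun y hy => ?_) (fun y hy => ?_) fun y hy => ?_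
    · simp only [Finset.mem_range] at hy ⊢
      omega
    · simp only [Finset.mem_sdiff, Finset.mem_range] at hy
      exact Nat.descFactorial_eq_zero_iff_lt.2 (by omega)
    · congr 1
      simp only [Finset.mem_range] at hy
      omega
  rw [h1, ← Finset.sum_mul, h2, ← mul_assoc, succ_mul_sum_range_descFactorial]

/-- The product for which `(2n+1) / (m+1) * windowRatio n m` is the expected number of windows of
`m` consecutive first occurrences in a random deal of size `n`. -/
noncomputable def windowRatio (n m : ℕ) : ℝ :=
  ∏ i ∈ Finset.range m, (2 * (n : ℝ) - 2 * i) / (2 * n + 1 - i)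

lemma windowRatio_succ (n m : ℕ) :
    windowRatio n (m + 1) = windowRatio n m * ((2 * (n : ℝ) - 2 * m) / (2 * n + 1 - m)) :=
  Finset.prod_range_succ _ _

lemma windowRatio_eq_zero {n m : ℕ} (h : n < m) : windowRatio n m = 0 :=
  Finset.prod_eq_zero (Finset.mem_range.2 h) (by simp)

lemma windowRatio_nonneg (n m : ℕ) : 0 ≤ windowRatio n m := by
  rcases lt_or_ge n m with h | h
  · exact (windowRatio_eq_zero h).ge
  · refine Finset.prod_nonneg fun i hi => ?_
    have hi : (i : ℝ) ≤ n := by exact_mod_cast (Finset.mem_range.1 hi).le.trans h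
    have hn : (0 : ℝ) ≤ n := n.cast_nonneg
    exact div_nonneg (by linarith) (by linarith)

lemma matchingCount_two_mul_pos (n : ℕ) : 0 < matchingCount (2 * n) := by
  induction n with
  | zero => exact one_pos
  | succ n ih => exact Nat.mul_pos (Nat.succ_pos _) ih

lemma card_deals (n : ℕ) : (deals n).card = matchingCount (2 * n) := by
  rw [deals_eq_involutionsOn, card_involutionsOn, Finset.card_univ, Fintype.card_fin]

lemma descFactorial_mul_matchingCount (n m : ℕ) :
    ((2 * n + 1 - m).descFactorial (m + 1) * matchingCount (2 * n - 2 * m) : ℝ) =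
      (2 * n + 1) * windowRatio n m * matchingCount (2 * n) := by
  rcases lt_or_ge n m with h | h
  · rw [windowRatio_eq_zero h, Nat.descFactorial_eq_zero_iff_lt.2 (by omega)]
    simp
  · induction m with
    | zero => simp [windowRatio]
    | succ m ih =>
      have ih := ih (by omega)
      obtain ⟨d, rfl⟩ : ∃ d, n = m + 1 + d := ⟨n - (m + 1), by omega⟩
      rw [windowRatio_succ]
      have e1 : 2 * (m + 1 + d) - 2 * m = 2 * d + 2 := by omega
      have e2 : 2 * (m + 1 + d) - 2 * (m + 1) = 2 * d := by omega
      have e3 : 2 * (m + 1 + d) + 1 - m = m + 2 * d + 2 + 1 := by omega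
      have e4 : 2 * (m + 1 + d) + 1 - (m + 1) = m + 2 * d + 2 := by omega
      rw [e1, e3, Nat.succ_descFactorial_succ, matchingCount] at ih
      have e5 : (m + 2 * d + 2).descFactorial (m + 2) =
          (2 * d + 1) * ((2 * d + 2) * (m + 2 * d + 2).descFactorial m) := by
        rw [Nat.descFactorial_succ, Nat.descFactorial_succ]
        congr 1
        · omega
        · congr 1
          omega
      rw [e2, e4, e5]
      push_cast at ih ⊢
      have hpos : (2 * ((m : ℝ) + 1 + d) + 1 - m) ≠ 0 := by
        have : (0 : ℝ) ≤ m := m.cast_nonneg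
        have : (0 : ℝ) ≤ d := d.cast_nonneg
        linarith
      field_simp
      linear_combination ((d : ℝ) + 1) * ih

lemma sum_windowCount (n m : ℕ) (hm : 1 ≤ m) :
    (∑ π ∈ deals n, (windowCount π m : ℝ)) =
      (2 * n + 1) * windowRatio n m / (m + 1) * (deals n).card := by
  have h := congrArg (Nat.cast (R := ℝ)) (succ_mul_sum_windowCount n m hm)
  push_cast at h
  rw [descFactorial_mul_matchingCount, ← card_deals] at h
  have : (0 : ℝ) < m + 1 := by positivity
  field_simp
  linarith

lemma eb_eq (n m : ℕ) (hm : 1 ≤ m) :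
    eb n (m + 1) = (2 * n + 1) * (windowRatio n m / (m + 1) -
      2 * windowRatio n (m + 1) / (m + 2) + windowRatio n (m + 2) / (m + 3)) := by
  have hc : (0 : ℝ) < (deals n).card := by
    rw [card_deals]
    exact_mod_cast matchingCount_two_mul_pos n
  have h : (bcount n (m + 1) : ℝ) + 2 * ∑ π ∈ deals n, (windowCount π (m + 1) : ℝ) =
      ∑ π ∈ deals n, (windowCount π m : ℝ) + ∑ π ∈ deals n, (windowCount π (m + 2) : ℝ) := by
    rw [bcount]
    push_cast
    rw [Finset.mul_sum, ← Finset.sum_add_distrib, ← Finset.sum_add_distrib]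
    refine Finset.sum_congr rfl fun π hπ => ?_
    exact_mod_cast count_blockLens_add hm (Finset.mem_filter.1 hπ).2
  rw [sum_windowCount n m hm, sum_windowCount n _ (by omega),
    sum_windowCount n _ (by omega)] at h
  rw [eb, div_eq_iff hc.ne']
  push_cast at h
  rw [show (m : ℝ) + 1 + 1 = m + 2 by ring, show (m : ℝ) + 2 + 1 = m + 3 by ring] at h
  linear_combination h

/-- `j (j+1) (j+2) / (2n+1)` times `db n j`, for `j = m + 1`. -/
noncomputable def defect (n m : ℕ) : ℝ :=
  (m + 2) * (m + 3) * windowRatio n m - 2 * (m + 1) * (m + 3) * windowRatio n (m + 1) +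
    (m + 1) * (m + 2) * windowRatio n (m + 2) - 2

lemma db_eq (n m : ℕ) (hm : 1 ≤ m) :
    db n (m + 1) = (2 * n + 1) * defect n m / ((m + 1) * (m + 2) * (m + 3)) := by
  rw [db, eb_eq n m hm, defect]
  push_cast
  field_simp
  ring

lemma defect_zero {n : ℕ} (hn : 1 ≤ n) : defect n 0 = 0 := by
  have : (0 : ℝ) < n := by exact_mod_cast hn
  simp [defect, windowRatio, Finset.prod_range_succ]
  field_simp
  ring

lemma defect_succ {n m : ℕ} (hmn : m + 1 ≤ n) :
    defect n (m + 1) = defect n m + (m + 2) * (m + 3) * (windowRatio n m * ((m + 1) *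
      (3 * (2 * n + 1) + 1 - 3 * (m + 1) - (m + 1) ^ 2)) /
        ((2 * n + 1 - m) * (2 * n - m) * (2 * n - 1 - m))) := by
  have h1 : (m : ℝ) + 1 ≤ n := by exact_mod_cast hmn
  have h0 : (0 : ℝ) ≤ m := m.cast_nonneg
  rw [defect, defect, windowRatio_succ n (m + 2), windowRatio_succ n (m + 1),
    windowRatio_succ n m]
  push_cast
  have e1 : (2 * n + 1 - m : ℝ) ≠ 0 := by linarith
  have e2 : (2 * n - m : ℝ) ≠ 0 := by linarith
  have e3 : (2 * n - 1 - m : ℝ) ≠ 0 := by linarith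
  rw [show (2 * n + 1 - (m + 1) : ℝ) = 2 * n - m by ring,
    show (2 * n + 1 - (m + 2) : ℝ) = 2 * n - 1 - m by ring]
  field_simp
  ring

lemma defect_eq_neg_two {n m : ℕ} (h : n < m) : defect n m = -2 := by
  simp [defect, windowRatio_eq_zero h, windowRatio_eq_zero (h.trans m.lt_succ_self),
    windowRatio_eq_zero (h.trans (by omega : m < m + 2))]

lemma defect_nonneg_of_sq_le {n m : ℕ} (hn : 1 ≤ n) (hmn : m ≤ n)
    (hm : (m : ℝ) ^ 2 + 3 * m ≤ 6 * n + 4) : 0 ≤ defect n m := by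
  induction m with
  | zero => exact (defect_zero hn).ge
  | succ m ih =>
    have h1 : (m : ℝ) + 1 ≤ n := by exact_mod_cast hmn
    have h0 : (0 : ℝ) ≤ m := m.cast_nonneg
    push_cast at hm
    rw [defect_succ hmn]
    have := ih (by omega) (by nlinarith)
    have hq := windowRatio_nonneg n m
    have e1 : (0 : ℝ) ≤ 2 * n + 1 - m := by linarith
    have e2 : (0 : ℝ) ≤ 2 * n - m := by linarith
    have e3 : (0 : ℝ) ≤ 2 * n - 1 - m := by linarith
    have e4 : (0 : ℝ) ≤ 3 * (2 * n + 1) + 1 - 3 * (m + 1) - (m + 1) ^ 2 := by nlinarith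
    positivity

lemma natCast_mul_sub_one_nonneg (m : ℕ) : (0 : ℝ) ≤ m * (m - 1) := by
  rcases m with _ | m
  · simp
  · push_cast
    simp only [add_sub_cancel_right]
    positivity

lemma defect_succ_le {n m : ℕ} (hmn : m + 1 ≤ n) :
    defect n (m + 1) ≤ defect n m + (m + 2) * (m + 3) * (3 * ((m + 1) *
      (windowRatio n m / (2 * n + 1 - m))) / (2 * n - 1)) := by
  have h1 : (m : ℝ) + 1 ≤ n := by exact_mod_cast hmn
  have h0 : (0 : ℝ) ≤ m := m.cast_nonneg
  have hm := natCast_mul_sub_one_nonneg m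
  have hq := windowRatio_nonneg n m
  have e1 : (0 : ℝ) < 2 * n + 1 - m := by linarith
  have e2 : (0 : ℝ) < 2 * n - m := by linarith
  have e3 : (0 : ℝ) < 2 * n - 1 - m := by linarith
  have e4 : (0 : ℝ) < 2 * n - 1 := by linarith
  have key : (3 * (2 * n + 1) + 1 - 3 * (m + 1) - (m + 1) ^ 2) / ((2 * n - m) * (2 * n - 1 - m)) ≤
      3 / (2 * n - 1 : ℝ) := by
    rw [div_le_div_iff₀ (by positivity) e4]
    nlinarith
  rw [defect_succ hmn]
  have h2 : 0 ≤ (m + 2 : ℝ) * (m + 3) * ((m + 1) * (windowRatio n m / (2 * n + 1 - m))) := by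
    positivity
  have h3 := mul_le_mul_of_nonneg_left key h2
  refine add_le_add_right ((le_of_eq ?_).trans (h3.trans_eq ?_)) _
  · field_simp
  · ring

lemma windowRatio_div_le {n m : ℕ} (hn : 1 ≤ n) (hmn : m ≤ n) :
    (2 * n + 1) * (windowRatio n m / (2 * n + 1 - m)) ≤
      2 * (2 * n + 1) / (2 * (2 * n + 1) + m * (m - 1) : ℝ) := by
  induction m with
  | zero =>
    have : (0 : ℝ) < 2 * n + 1 := by positivity
    simp only [windowRatio, Finset.prod_range_zero, Nat.cast_zero, sub_zero, zero_mul, add_zero]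
    field_simp
    rfl
  | succ m ih =>
    have h1 : (m : ℝ) + 1 ≤ n := by exact_mod_cast hmn
    have h0 : (0 : ℝ) ≤ m := m.cast_nonneg
    have hm := natCast_mul_sub_one_nonneg m
    have e1 : (0 : ℝ) < 2 * n + 1 - m := by linarith
    have e2 : (0 : ℝ) < 2 * n - m := by linarith
    have e3 : (0 : ℝ) ≤ 2 * n - 2 * m := by linarith
    have ih := mul_le_mul_of_nonneg_right (ih (by omega)) (div_nonneg e3 e2.le)
    rw [windowRatio_succ]
    push_cast
    rw [show (2 * n + 1 - (m + 1) : ℝ) = 2 * n - m by ring, add_sub_cancel_right]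
    calc _ = (2 * n + 1) * (windowRatio n m / (2 * n + 1 - m)) *
          ((2 * n - 2 * m) / (2 * n - m) : ℝ) := by ring
      _ ≤ _ := ih
      _ ≤ _ := by
        rw [div_mul_div_comm, div_le_div_iff₀ (by positivity) (by positivity)]
        have : (0 : ℝ) ≤ 2 * (2 * n + 1) := by positivity
        have h4 : (2 * n - 2 * m) * (2 * (2 * n + 1) + (m + 1) * m) ≤
            (2 * (2 * n + 1) + m * (m - 1)) * (2 * n - m : ℝ) := by
          nlinarith [mul_nonneg h0 h0, mul_nonneg (mul_nonneg h0 h0) h0]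
        nlinarith [mul_le_mul_of_nonneg_left h4 this]

lemma defect_le {n m : ℕ} {M : ℝ} (hM0 : 0 ≤ M) (hn : 1 ≤ n) (hmn : m ≤ n)
    (hM : ∀ k < m, (2 * n + 1) * ((k + 1) * (windowRatio n k / (2 * n + 1 - k))) ≤ M) :
    (2 * n + 1) * defect n m ≤ (m + 1) * (m + 2) * (m + 3) * (M / (2 * n - 1)) := by
  induction m with
  | zero =>
    rw [defect_zero hn]
    have hn' : (1 : ℝ) ≤ n := by exact_mod_cast hn
    rw [mul_zero]
    have : (0 : ℝ) ≤ 2 * n - 1 := by linarith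
    positivity
  | succ m ih =>
    have hn' : (1 : ℝ) ≤ n := by exact_mod_cast hn
    have h1 := defect_succ_le hmn
    have h2 := hM m (by omega)
    have h3 := ih (by omega) fun k hk => hM k (by omega)
    have e4 : (0 : ℝ) < 2 * n - 1 := by linarith
    have h4 := div_le_div_of_nonneg_right h2 e4.le
    have h5 := mul_le_mul_of_nonneg_left h4
      (by positivity : (0 : ℝ) ≤ 3 * ((m + 2) * (m + 3)))
    have h6 := mul_le_mul_of_nonneg_left h1 (by positivity : (0 : ℝ) ≤ 2 * n + 1)
    push_cast
    calc _ ≤ _ := h6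
      _ = (2 * n + 1) * defect n m + 3 * ((m + 2) * (m + 3)) * ((2 * n + 1) *
          ((m + 1) * (windowRatio n m / (2 * n + 1 - m))) / (2 * n - 1)) := by ring
      _ ≤ _ := add_le_add h3 h5
      _ = _ := by ring

lemma succ_mul_windowRatio_le {n k : ℕ} (hn : 12 ≤ n) (hk : k ≤ n) :
    (2 * n + 1) * ((k + 1) * (windowRatio n k / (2 * n + 1 - k))) ≤
      3 / 4 * √(3.14 / 2 * (2 * n - 1)) := by
  have hn' : (12 : ℝ) ≤ n := by exact_mod_cast hn
  have hk0 : (0 : ℝ) ≤ k := k.cast_nonneg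
  have hkk := natCast_mul_sub_one_nonneg k
  obtain ⟨s, hs0, hs⟩ : ∃ s : ℝ, 0 ≤ s ∧ s ^ 2 = 2 * (2 * n + 1) + 2 :=
    ⟨√(2 * (2 * n + 1) + 2), Real.sqrt_nonneg _, Real.sq_sqrt (by positivity)⟩
  have hs7 : 7.2 ≤ s := by nlinarith
  have h1 : (2 * n + 1) * ((k + 1) * (windowRatio n k / (2 * n + 1 - k))) ≤
      2 * (2 * n + 1) / (2 * s - 3) := by
    calc _ = (k + 1) * ((2 * n + 1) * (windowRatio n k / (2 * n + 1 - k))) := by ring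
      _ ≤ (k + 1) * (2 * (2 * n + 1) / (2 * (2 * n + 1) + k * (k - 1))) :=
        mul_le_mul_of_nonneg_left (windowRatio_div_le (by omega) hk) (by positivity)
      _ ≤ _ := by
        rw [mul_div_assoc', div_le_div_iff₀ (by positivity) (by linarith)]
        have h2 : (k + 1) * (2 * s - 3) ≤ 2 * (2 * n + 1) + k * (k - 1 : ℝ) := by
          nlinarith [sq_nonneg (s - (k + 1))]
        nlinarith [mul_le_mul_of_nonneg_left h2 (by positivity : (0 : ℝ) ≤ 2 * (2 * n + 1))]
  refine h1.trans ?_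
  have h3 : (4 / 3 * (2 * (2 * n + 1) / (2 * s - 3))) ≤ √(3.14 / 2 * (2 * n - 1)) := by
    refine Real.le_sqrt_of_sq_le ?_
    obtain ⟨t, ht, rfl⟩ : ∃ t : ℝ, 0 ≤ t ∧ s = 7.2 + t := ⟨s - 7.2, by linarith, by ring⟩
    obtain hn2 : (n : ℝ) = ((7.2 + t) ^ 2 - 4) / 4 := by linarith
    have hpos : 0 < 2 * (7.2 + t) - 3 := by linarith
    rw [mul_div_assoc', div_pow, div_le_iff₀ (by positivity), hn2, ← sub_nonneg]
    ring_nf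
    positivity
  linarith

lemma abs_db_le_of_lt_twelve {n m : ℕ} (hn : 1 ≤ n) (hn12 : n < 12) (hm : 1 ≤ m) (hmn : m ≤ n) :
    |(2 * n + 1) * defect n m / ((m + 1) * (m + 2) * (m + 3))| ≤
      3 / 4 * √(3.14 / (2 * (2 * n - 1))) := by
  have h : |4 / 3 * ((2 * n + 1) * defect n m / ((m + 1) * (m + 2) * (m + 3)))| ≤
      √(3.14 / (2 * (2 * n - 1))) := by
    refine Real.abs_le_sqrt ?_
    interval_cases n <;> interval_cases m <;>
      norm_num [defect, windowRatio, Finset.prod_range_succ]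
  rw [abs_mul, abs_of_pos (by norm_num : (0 : ℝ) < 4 / 3)] at h
  linarith

lemma neg_two_le_defect (n m : ℕ) (hm : 1 ≤ m) : -2 ≤ defect n m := by
  have h : 0 ≤ eb n (m + 1) := by rw [eb]; positivity
  have h1 : eb n (m + 1) = (2 * n + 1) / ((m + 1) * (m + 2) * (m + 3)) * (defect n m + 2) := by
    rw [eb_eq n m hm, defect]
    field_simp
    ring
  rw [h1, mul_nonneg_iff_of_pos_left (by positivity)] at h
  linarith

lemma main_term_le {n m : ℕ} (hn : 1 ≤ n) (hm : (6 * n + 4 : ℝ) ≤ m ^ 2 + 3 * m) :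
    (2 * n + 1) * 2 / ((m + 1) * (m + 2) * (m + 3) : ℝ) ≤
      3 / 4 * √(3.14 / (2 * (2 * n - 1))) := by
  have hn' : (1 : ℝ) ≤ n := by exact_mod_cast hn
  have hm0 : (0 : ℝ) ≤ m := m.cast_nonneg
  have e : (0 : ℝ) < 2 * n - 1 := by linarith
  have h1 : (2 * n + 1) * 2 / ((m + 1) * (m + 2) * (m + 3) : ℝ) ≤ 2 / 3 / (m + 3) := by
    rw [div_le_div_iff₀ (by positivity) (by positivity)]
    nlinarith
  have h2 : 4 / 3 * (2 / 3 / (m + 3) : ℝ) ≤ √(3.14 / (2 * (2 * n - 1))) := by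
    refine Real.le_sqrt_of_sq_le ?_
    rw [div_div, mul_div_assoc', div_pow, div_le_div_iff₀ (by positivity) (by positivity)]
    nlinarith
  linarith

lemma defect_le_of_twelve_le {n m : ℕ} (hn : 12 ≤ n) (hmn : m ≤ n) :
    (2 * n + 1) * defect n m / ((m + 1) * (m + 2) * (m + 3)) ≤
      3 / 4 * √(3.14 / (2 * (2 * n - 1))) := by
  have hn' : (12 : ℝ) ≤ n := by exact_mod_cast hn
  have e : (0 : ℝ) < 2 * n - 1 := by linarith
  have h := defect_le (by positivity) (by omega) hmn fun k hk =>
    succ_mul_windowRatio_le hn (hk.le.trans hmn)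
  have h2 : √(3.14 / 2 * (2 * n - 1)) / (2 * n - 1) = √(3.14 / (2 * (2 * n - 1))) := by
    rw [div_eq_iff e.ne']
    nth_rw 3 [← Real.sqrt_sq e.le]
    rw [← Real.sqrt_mul (by positivity)]
    congr 1
    field_simp
  rw [div_le_iff₀' (by positivity), ← h2, ← mul_div_assoc]
  exact h

/-- For `n ≥ 1` and `j ≥ 2`, `|db(n,j)| ≤ (3/4)·√(π/(2(2n-1)))`. -/
theorem abs_db_le_sqrt (n j : ℕ) (hn : 1 ≤ n) (hj : 2 ≤ j) :
    |db n j| ≤ (3/4) * Real.sqrt (Real.pi / (2*(2*(n:ℝ)-1))) := by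
  obtain ⟨m, rfl⟩ : ∃ m, j = m + 1 := ⟨j - 1, by omega⟩
  have hm : 1 ≤ m := by omega
  have hn' : (1 : ℝ) ≤ n := by exact_mod_cast hn
  have e : (0 : ℝ) < 2 * n - 1 := by linarith
  have hpi : 3 / 4 * √(3.14 / (2 * (2 * (n : ℝ) - 1))) ≤
      3 / 4 * √(Real.pi / (2 * (2 * (n : ℝ) - 1))) := by
    gcongr
    exact Real.pi_gt_d2.le
  refine le_trans ?_ hpi
  rw [db_eq n m hm]
  by_cases hlarge : n < 12 ∧ m ≤ n
  · exact abs_db_le_of_lt_twelve hn hlarge.1 hm hlarge.2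
  rw [abs_le]
  constructor
  · by_cases hsq : m ≤ n ∧ (m : ℝ) ^ 2 + 3 * m ≤ 6 * n + 4
    · have := defect_nonneg_of_sq_le hn hsq.1 hsq.2
      exact (neg_nonpos.2 (by positivity)).trans (by positivity)
    · have hsq' : (6 * n + 4 : ℝ) ≤ m ^ 2 + 3 * m := by
        rcases le_or_gt m n with h | h
        · exact (not_le.1 fun h' => hsq ⟨h, h'⟩).le
        · have : (n : ℝ) + 1 ≤ m := by exact_mod_cast h
          nlinarith
      rw [neg_le]
      refine le_trans ?_ (main_term_le hn hsq')
      rw [← neg_div, ← mul_neg]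
      gcongr
      linarith [neg_two_le_defect n m hm]
  · rcases le_or_gt m n with h | h
    · exact defect_le_of_twelve_le (by omega) h
    · rw [defect_eq_neg_two h]
      refine le_trans (div_nonpos_of_nonpos_of_nonneg ?_ (by positivity)) (by positivity)
      linarith
end

section
/- For every integer n ≥ 1, the series ∑_{j=2}^∞ db(n,j) converges, with sum 1/2. -/
open scoped Classical

theorem hasSum_count_list (l : List ℕ) :
    HasSum (fun j : ℕ => (l.count j : ℝ)) l.length := by
  induction l with
  | nil => simp
  | cons x l ih =>
    have h := ih.add (hasSum_ite_eq x (1 : ℝ))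
    rw [List.length_cons, Nat.cast_succ]
    refine h.congr_fun fun j => ?_
    simp only [List.count_cons, beq_iff_eq, Nat.cast_add, Nat.cast_ite, Nat.cast_one,
        Nat.cast_zero, eq_comm (a := x)]

theorem one_le_of_mem_zipWith_sub (p : ℕ) (l : List ℕ) (h : (p :: l).Pairwise (· < ·)) :
    ∀ x ∈ List.zipWith (fun x y => x - y) l (p :: l), 1 ≤ x := by
  induction l generalizing p with
  | nil => simp
  | cons x l ih =>
    rw [List.pairwise_cons] at h
    have hx := h.1 x (by simp)
    simp only [List.zipWith_cons_cons, List.mem_cons]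
    rintro y (rfl | hy)
    · omega
    · exact ih x h.2 y hy

theorem count_one_zipWith_sub (p : ℕ) (l : List ℕ) (h : (p :: l).Pairwise (· < ·)) :
    (List.zipWith (fun x y => x - y) l (p :: l)).count 1 =
      l.countP (fun y => decide (y - 1 ∈ p :: l)) := by
  induction l generalizing p with
  | nil => simp
  | cons x l ih =>
    rw [List.pairwise_cons] at h
    have hpx := h.1 x (by simp)
    have hxl := (List.pairwise_cons.1 h.2).1
    rw [List.zipWith_cons_cons, List.count_cons, ih x h.2, List.countP_cons]
    congr 1
    · apply List.countP_congr
      intro y hy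
      have := hxl y hy
      simp only [decide_eq_true_eq, List.mem_cons]
      constructor
      · exact Or.inr
      · rintro (h1 | h1)
        · omega
        · exact h1
    · have : x - p = 1 ↔ x - 1 ∈ p :: x :: l := by
        simp only [List.mem_cons]
        constructor
        · intro; left; omega
        · rintro (h1 | h1 | h1)
          · omega
          · omega
          · have := hxl _ h1
            omega
      simp [this]

section BlockLens

variable {n : ℕ} (π : Fin (2 * n) → Fin (2 * n))

theorem blockLens_eq : blockLens π = List.zipWith (fun x y => x - y)
    ((blockEnds π).map (fun j : Fin (2 * n) => (j : ℕ) + 1))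
    (0 :: (blockEnds π).map (fun j : Fin (2 * n) => (j : ℕ) + 1)) := by
  have h : (blockEnds π >>= fun a => pure (a : ℕ)) = (blockEnds π).map (fun a : Fin (2 * n) => (a : ℕ)) :=
    List.flatMap_pure_eq_map _ _
  rw [blockLens, h, List.map_map]
  rfl

theorem pairwise_blockEnds :
    (0 :: (blockEnds π).map (fun j : Fin (2 * n) => (j : ℕ) + 1)).Pairwise (· < ·) := by
  rw [List.pairwise_cons]
  constructor
  · simp
  · rw [List.pairwise_map]
    refine (Finset.sortedLT_sort (Finset.univ.filter (fun j => π j < j))).pairwise.imp ?_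
    intro a b h
    have : (a : ℕ) < b := h
    omega

theorem count_zero_blockLens : (blockLens π).count 0 = 0 := by
  rw [List.count_eq_zero]
  rw [blockLens_eq]
  intro h
  have := one_le_of_mem_zipWith_sub _ _ (pairwise_blockEnds π) _ h
  omega

theorem length_blockLens :
    (blockLens π).length = (Finset.univ.filter (fun j => π j < j)).card := by
  simp [blockLens_eq, blockEnds]

theorem count_one_blockLens :
    (blockLens π).count 1 = (Finset.univ.filter (fun d : Fin (2 * n) =>
      π d < d ∧ ∃ c : Fin (2 * n), π c < c ∧ (c : ℕ) + 1 = d)).card := by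
  have h := count_one_zipWith_sub _ _ (pairwise_blockEnds π)
  rw [blockLens_eq, h, List.countP_map]
  have key : ∀ (s : Finset (Fin (2 * n))) (q : Fin (2 * n) → Bool),
      (s.sort (· ≤ ·)).countP q = (s.filter (fun j => q j = true)).card := by
    intro s q
    rw [List.countP_eq_length_filter, ← List.toFinset_card_of_nodup
      ((Finset.sort_nodup _ _).filter _), List.toFinset_filter, Finset.sort_toFinset]
  rw [blockEnds, key, Finset.filter_filter]
  congr 1
  ext d
  simp only [Finset.mem_filter, Finset.mem_univ, true_and, Function.comp_apply,
    Nat.add_sub_cancel, List.mem_cons, List.mem_map, Finset.mem_sort, decide_eq_true_eq]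
  refine and_congr_right fun hd => ?_
  have : (π d : ℕ) < d := hd
  constructor
  · rintro (h0 | h1)
    · omega
    · exact h1
  · exact Or.inr

end BlockLens

theorem card_second_occurrences {n : ℕ} {π : Fin (2 * n) → Fin (2 * n)} (hπ : IsDeal n π) :
    (Finset.univ.filter (fun j => π j < j)).card = n := by
  have h1 : (Finset.univ.filter (fun j => π j < j)).card =
      (Finset.univ.filter (fun j => ¬ π j < j)).card := by
    refine Finset.card_nbij' π π ?_ ?_ ?_ ?_
    · intro j hj
      simp only [Finset.coe_filter, Finset.mem_univ, true_and, Set.mem_ofPred_eq] at hj ⊢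
      rw [(hπ j).1]
      exact hj.le.not_gt
    · intro j hj
      simp only [Finset.coe_filter, Finset.mem_univ, true_and, Set.mem_ofPred_eq] at hj ⊢
      rw [(hπ j).1]
      exact lt_of_le_of_ne (not_lt.1 hj) (hπ j).2.symm
    · intro j _
      exact (hπ j).1
    · intro j _
      exact (hπ j).1
  have h2 := Finset.card_filter_add_card_filter_not (s := Finset.univ) (fun j => π j < j)
  rw [Finset.card_univ, Fintype.card_fin] at h2
  omega

theorem deals_nonempty (n : ℕ) : (deals n).Nonempty := by
  refine ⟨Fin.rev, ?_⟩
  simp only [deals, Finset.mem_filter, Finset.mem_univ, true_and]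
  intro j
  refine ⟨Fin.rev_rev j, fun h => ?_⟩
  have := congrArg Fin.val h
  rw [Fin.val_rev] at this
  omega

theorem isDeal_conj {n : ℕ} {π : Fin (2 * n) → Fin (2 * n)} (hπ : IsDeal n π)
    (σ : Equiv.Perm (Fin (2 * n))) : IsDeal n (fun j => σ (π (σ.symm j))) := by
  intro j
  constructor
  · simp [(hπ _).1]
  · intro h
    apply (hπ (σ.symm j)).2
    rw [Equiv.eq_symm_apply]
    exact h

/-- The number of deals pairing `c` with `a` and `d` with `b`. -/
noncomputable def pairCount (n : ℕ) (c a d b : Fin (2 * n)) : ℕ :=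
  ((deals n).filter (fun π => π c = a ∧ π d = b)).card

theorem pairCount_conj_le {n : ℕ} (c a d b : Fin (2 * n)) (σ : Equiv.Perm (Fin (2 * n))) :
    pairCount n c a d b ≤ pairCount n (σ c) (σ a) (σ d) (σ b) := by
  refine Finset.card_le_card_of_injOn (fun π j => σ (π (σ.symm j))) ?_ ?_
  · intro π hπ
    simp only [deals, Finset.coe_filter, Finset.mem_filter, Finset.mem_univ, true_and,
      Set.mem_ofPred_eq, Equiv.symm_apply_apply, EmbeddingLike.apply_eq_iff_eq] at hπ ⊢
    exact ⟨isDeal_conj hπ.1 σ, hπ.2⟩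
  · intro π _ ρ _ h
    ext j
    have := congrFun h (σ j)
    simp only [Equiv.symm_apply_apply, EmbeddingLike.apply_eq_iff_eq] at this
    rw [this]

theorem pairCount_le {n : ℕ} (x y : Fin 4 ↪ Fin (2 * n)) :
    pairCount n (x 0) (x 1) (x 2) (x 3) ≤ pairCount n (y 0) (y 1) (y 2) (y 3) := by
  obtain ⟨σ, hσ⟩ := (Equiv.Perm.isMultiplyPretransitive (Fin (2 * n)) 4).exists_smul_eq x y
  have h : ∀ i, σ (x i) = y i := fun i => by rw [← hσ]; rfl
  rw [← h 0, ← h 1, ← h 2, ← h 3]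
  exact pairCount_conj_le _ _ _ _ σ

theorem exists_pairCount_eq (n : ℕ) : ∃ K, ∀ c a d b : Fin (2 * n),
    [c, a, d, b].Nodup → pairCount n c a d b = K := by
  have emb : ∀ c a d b : Fin (2 * n), [c, a, d, b].Nodup →
      ∃ x : Fin 4 ↪ Fin (2 * n), x 0 = c ∧ x 1 = a ∧ x 2 = d ∧ x 3 = b := by
    intro c a d b h
    exact ⟨⟨[c, a, d, b].get, List.nodup_iff_injective_get.1 h⟩, rfl, rfl, rfl, rfl⟩
  by_cases h : Nonempty (Fin 4 ↪ Fin (2 * n))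
  · obtain ⟨y⟩ := h
    refine ⟨pairCount n (y 0) (y 1) (y 2) (y 3), fun c a d b hn => ?_⟩
    obtain ⟨x, rfl, rfl, rfl, rfl⟩ := emb c a d b hn
    exact (pairCount_le x y).antisymm (pairCount_le y x)
  · refine ⟨0, fun c a d b hn => ?_⟩
    obtain ⟨x, -⟩ := emb c a d b hn
    exact (h ⟨x⟩).elim

theorem card_deals_eq {n K : ℕ} (hn : 2 ≤ n)
    (hK : ∀ c a d b : Fin (2 * n), [c, a, d, b].Nodup → pairCount n c a d b = K) :
    (deals n).card = (2 * n - 1) * ((2 * n - 3) * K) := by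
  have card_fiber : ∀ c a : Fin (2 * n), c ≠ a →
      ((deals n).filter (fun π => π c = a)).card = (2 * n - 3) * K := by
    intro c a hca
    obtain ⟨d, hd⟩ : ∃ d, d ∉ ({c, a} : Finset (Fin (2 * n))) := by
      by_contra! h
      have h1 := Finset.card_le_card (fun d _ => h d : Finset.univ ⊆ {c, a})
      have h2 := Finset.card_le_two (a := c) (b := a)
      rw [Finset.card_univ, Fintype.card_fin] at h1
      omega
    simp only [Finset.mem_insert, Finset.mem_singleton, not_or] at hd
    rw [Finset.card_eq_sum_card_fiberwise (f := fun π => π d) (t := {c, a, d}ᶜ)]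
    · rw [Finset.sum_congr rfl (g := fun _ => K), Finset.sum_const, Finset.card_compl,
        Fintype.card_fin, smul_eq_mul, Finset.card_eq_three.2
          ⟨c, a, d, hca, Ne.symm hd.1, Ne.symm hd.2, rfl⟩]
      intro b hb
      rw [Finset.filter_filter]
      refine hK c a d b ?_
      simp only [Finset.mem_compl, Finset.mem_insert, Finset.mem_singleton, not_or] at hb
      simp only [List.nodup_cons, List.mem_cons, List.not_mem_nil, or_false, not_or,
        not_false_eq_true, List.nodup_nil, and_true]
      tauto
    · intro π hπ
      simp only [deals, Finset.coe_filter, Finset.mem_filter, Finset.mem_univ, true_and,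
        Set.mem_ofPred_eq] at hπ
      obtain ⟨h, rfl⟩ := hπ
      simp only [Finset.coe_compl, Set.mem_compl_iff, Finset.mem_coe, Finset.mem_insert,
        Finset.mem_singleton, not_or]
      refine ⟨fun h1 => hd.2 ?_, fun h1 => hd.1 ?_, (h d).2⟩
      · rw [← h1, (h d).1]
      · rw [← (h d).1, h1, (h c).1]
  let c : Fin (2 * n) := ⟨0, by omega⟩
  rw [Finset.card_eq_sum_card_fiberwise (f := fun π => π c) (t := {c}ᶜ)]
  · rw [Finset.sum_congr rfl (g := fun _ => (2 * n - 3) * K), Finset.sum_const,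
      Finset.card_compl, Fintype.card_fin, smul_eq_mul, Finset.card_singleton]
    intro a ha
    refine card_fiber c a fun h => ?_
    simp [h] at ha
  · intro π hπ
    simp only [deals, Finset.coe_filter, Finset.mem_univ, true_and, Set.mem_ofPred_eq] at hπ
    simpa using (hπ c).2

theorem card_adjacent_second {n K : ℕ}
    (hK : ∀ c a d b : Fin (2 * n), [c, a, d, b].Nodup → pairCount n c a d b = K)
    (d : Fin (2 * n)) :
    ((deals n).filter (fun π => π d < d ∧ ∃ c : Fin (2 * n), π c < c ∧ (c : ℕ) + 1 = (d : ℕ))).card =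
      ((d : ℕ) - 1) * ((d : ℕ) - 2) * K := by
  by_cases h0 : (d : ℕ) = 0
  · rw [Finset.card_eq_zero.2]
    · simp [h0]
    · refine Finset.filter_eq_empty_iff.2 ?_
      rintro π - ⟨h, -⟩
      have : (π d : ℕ) < d := h
      omega
  let c : Fin (2 * n) := ⟨(d : ℕ) - 1, by omega⟩
  have hcd : (c : ℕ) + 1 = d := by simp only [c]; omega
  rw [Finset.card_eq_sum_card_fiberwise (f := fun π => (π c, π d)) (t := (Finset.Iio c).offDiag)]
  · rw [Finset.sum_congr rfl (g := fun _ => K), Finset.sum_const, Finset.offDiag_card,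
      Fin.card_Iio, smul_eq_mul]
    · have : (c : ℕ) = d - 1 := rfl
      rw [this, ← Nat.mul_sub_one, Nat.sub_sub]
    · rintro ⟨a, b⟩ hab
      simp only [Finset.mem_offDiag, Finset.mem_Iio, Fin.lt_def] at hab
      rw [← hK c a d b]
      · rw [pairCount, Finset.filter_filter]
        congr 1
        refine Finset.filter_congr fun π _ => ?_
        simp only [Prod.mk.injEq]
        refine ⟨fun h => h.2, fun h => ⟨⟨?_, c, ?_, hcd⟩, h⟩⟩
        · rw [h.2, Fin.lt_def]; omega
        · rw [h.1, Fin.lt_def]; omega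
      · have h1 := hab.2.2
        simp only [List.nodup_cons, List.mem_cons, List.not_mem_nil, or_false, not_or,
          not_false_eq_true, List.nodup_nil, and_true, Fin.ext_iff] at h1 ⊢
        omega
  · intro π hπ
    simp only [deals, Finset.coe_filter, Finset.mem_filter, Finset.mem_univ, true_and,
      Set.mem_ofPred_eq] at hπ
    obtain ⟨h, hd, c', hc', hcd'⟩ := hπ
    obtain rfl : c' = c := Fin.ext (by omega)
    have hne : π d ≠ c := fun h1 => by
      rw [← h1, (h d).1, h1, Fin.lt_def] at hc'
      omega
    have hne' : π c ≠ π d := fun h1 => by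
      have := congrArg π h1
      rw [(h c).1, (h d).1] at this
      rw [← this] at hcd
      omega
    simp only [Finset.mem_coe, Finset.mem_offDiag, Finset.mem_Iio]
    refine ⟨hc', ?_, hne'⟩
    rw [Fin.lt_def] at hd ⊢
    rw [Ne, Fin.ext_iff] at hne
    omega

theorem three_mul_sum_range (N : ℕ) :
    3 * ∑ d ∈ Finset.range N, (d - 1) * (d - 2) = (N - 1) * (N - 2) * (N - 3) := by
  induction N with
  | zero => simp
  | succ N ih =>
    rw [Finset.sum_range_succ, mul_add, ih]
    rcases N with _ | _ | _ | m
    · simp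
    · simp
    · simp
    · simp only [Nat.add_sub_cancel, show m + 1 + 1 + 1 - 1 = m + 2 by omega,
        show m + 1 + 1 + 1 - 2 = m + 1 by omega, show m + 1 + 1 + 1 - 3 = m by omega,
        show m + 1 + 1 + 1 + 1 - 2 = m + 2 by omega, show m + 1 + 1 + 1 + 1 - 3 = m + 1 by omega]
      ring

theorem three_mul_bcount_one (n : ℕ) (hn : 1 ≤ n) :
    3 * bcount n 1 = (2 * n - 2) * (deals n).card := by
  obtain ⟨K, hK⟩ := exists_pairCount_eq n
  have h : bcount n 1 = (∑ d ∈ Finset.range (2 * n), (d - 1) * (d - 2)) * K := by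
    rw [← Fin.sum_univ_eq_sum_range (fun d => (d - 1) * (d - 2)) (2 * n), Finset.sum_mul, bcount]
    simp only [count_one_blockLens, ← card_adjacent_second hK, Finset.card_filter]
    exact Finset.sum_comm
  rw [h, ← mul_assoc, three_mul_sum_range]
  rcases hn.eq_or_lt with rfl | hn
  · simp
  · rw [card_deals_eq hn hK]
    ring

theorem hasSum_eb (n : ℕ) : HasSum (fun j => eb n j) n := by
  have hD : ((deals n).card : ℝ) ≠ 0 := by
    exact_mod_cast (deals_nonempty n).card_pos.ne'
  have h : HasSum (fun j => ∑ π ∈ deals n, ((blockLens π).count j : ℝ))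
      (∑ π ∈ deals n, ((blockLens π).length : ℝ)) :=
    hasSum_sum fun π _ => hasSum_count_list (blockLens π)
  have h2 : ∑ π ∈ deals n, ((blockLens π).length : ℝ) = n * (deals n).card := by
    rw [Finset.sum_congr rfl (g := fun _ => (n : ℝ)), Finset.sum_const, nsmul_eq_mul, mul_comm]
    intro π hπ
    rw [length_blockLens, card_second_occurrences (Finset.mem_filter.1 hπ).2]
  rw [h2] at h
  have h3 := h.div_const ((deals n).card : ℝ)
  rw [mul_div_cancel_right₀ _ hD] at h3
  refine h3.congr_fun fun j => ?_
  simp [eb, bcount]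

theorem hasSum_inv_three_consecutive :
    HasSum (fun j : ℕ => 1 / (((j + 2 : ℕ) : ℝ) * (((j + 2 : ℕ) : ℝ) + 1) *
      (((j + 2 : ℕ) : ℝ) + 2))) (1 / 12) := by
  rw [hasSum_iff_tendsto_nat_of_nonneg (fun j => by positivity)]
  have h : ∀ N : ℕ, ∑ j ∈ Finset.range N, 1 / (((j + 2 : ℕ) : ℝ) * (((j + 2 : ℕ) : ℝ) + 1) *
      (((j + 2 : ℕ) : ℝ) + 2)) = 1 / 12 - 1 / 2 * ((1 / ((N : ℝ) + 2)) * (1 / ((N : ℝ) + 3))) := by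
    intro N
    induction N with
    | zero => norm_num
    | succ N ih =>
      rw [Finset.sum_range_succ, ih]
      push_cast
      field_simp
      ring
  simp only [h]
  have key : ∀ k : ℕ, Filter.Tendsto (fun N : ℕ => 1 / ((N : ℝ) + k)) Filter.atTop (nhds 0) := by
    intro k
    have := (Filter.tendsto_add_atTop_iff_nat k).2 (tendsto_one_div_atTop_nhds_zero_nat (𝕜 := ℝ))
    simpa using this
  have := (((key 2).mul (key 3)).const_mul (1 / 2 : ℝ)).const_sub (1 / 12 : ℝ)
  simpa using this

/-- For `n ≥ 1`, the series `∑_{j=2}^∞ db(n,j)` converges to `1/2`. -/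
theorem hasSum_db (n : ℕ) (hn : 1 ≤ n) :
    HasSum (fun j : ℕ => db n (j+2)) (1/2) := by
  have hD : ((deals n).card : ℝ) ≠ 0 := by
    exact_mod_cast (deals_nonempty n).card_pos.ne'
  have hzero : eb n 0 = 0 := by
    simp [eb, bcount, count_zero_blockLens]
  have hone : eb n 1 = (2 * n - 2) / 3 := by
    have h := congrArg (Nat.cast (R := ℝ)) (three_mul_bcount_one n hn)
    rw [Nat.cast_mul, Nat.cast_mul, Nat.cast_sub (by omega)] at h
    push_cast at h
    rw [eb, div_eq_div_iff hD three_ne_zero]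
    linarith
  have h := ((hasSum_nat_add_iff' 2).2 (hasSum_eb n)).sub
    (hasSum_inv_three_consecutive.mul_left (2 * (2 * (n : ℝ) + 1)))
  rw [Finset.sum_range_succ, Finset.sum_range_one, hzero, hone] at h
  rw [show (1 / 2 : ℝ) = n - (0 + (2 * n - 2) / 3) - 2 * (2 * n + 1) * (1 / 12) by ring]
  refine h.congr_fun fun j => ?_
  rw [db, mul_one_div]
end
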